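/- Fix cog ∈ C with cog > cog*. Let V : ℤ × C → ℝ satisfy the value-bound property with constants t_s, t_max, ρ. Assume E[τ|cog,H] > E[τ|cog,N] and that E[τ|cog,H] − E[τ|cog,N] + t_s·γ^{E[τ|cog,H]}/(1 − γ^{t_max}) ≥ (t_max/(1−ρ))·E[γ^τ|cog,N]. Then the map q ↦ Q_V(q,cog,N) − Q_V(q,cog,H) is nondecreasing on ℤ; consequently, if Q_V(q₁,cog,N) > Q_V(q₁,cog,H) for some q₁, then Q_V(q₂,cog,N) > Q_V(q₂,cog,H) for every q₂ ≥ q₁, i.e., there is a threshold q₁*(cog) above which action N strictly dominates action H. -/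

import Mathlib

open scoped BigOperators

namespace Fidelity

/-- The actions available to the human operator: skip, rest, normal fidelity, high fidelity. -/
inductive Action : Type
  | S | R | N | H
deriving DecidableEq

/-- Admissible action set: `{S, N, H}` for `cog ≤ cog*` and `{S, R, N, H}` for `cog > cog*`. -/
def Act {C : Type*} [LinearOrder C] (cogStar cog : C) : Finset Action :=
  if cog ≤ cogStar then {Action.S, Action.N, Action.H}
  else {Action.S, Action.R, Action.N, Action.H}

lemma Act_nonempty {C : Type*} [LinearOrder C] (cogStar cog : C) :
    (Act cogStar cog).Nonempty := by
  unfold Act; split <;> exact ⟨Action.S, by simp⟩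

/-- The reward `r(a)`: `r(H) = r_H`, `r(N) = r_N`, `r(S) = r(R) = 0`. -/
noncomputable def rew (rH rN : ℝ) : Action → ℝ
  | Action.H => rH
  | Action.N => rN
  | _ => 0

/-- Expected net immediate reward
`R((q,cog),a) = r(a) − c·E[τ|cog,a]·q − (cλ/2)·E[τ²|cog,a]`. -/
noncomputable def Rimm {C : Type*} (c lam rH rN : ℝ) (Etau Etau2 : C → Action → ℝ)
    (q : ℤ) (cog : C) (a : Action) : ℝ :=
  rew rH rN a - c * Etau cog a * (q : ℝ) - c * lam / 2 * Etau2 cog a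

/-- The Poisson probability of `w` arrivals when the mean number of arrivals is `μ`. -/
noncomputable def poissonPMF (μ : ℝ) (w : ℕ) : ℝ :=
  Real.exp (-μ) * μ ^ w / (w.factorial : ℝ)

/-- The next queue length: `q − 1 + w` under actions `S, N, H` and `q + w` under `R`. -/
def nextQ (a : Action) (q : ℤ) (w : ℕ) : ℤ :=
  if a = Action.R then q + (w : ℤ) else q - 1 + (w : ℤ)

/-- `E[γ^τ | cog, a]`, the expected discount over a sojourn in state `cog` under action `a`. -/
noncomputable def Egamma {C : Type*} [Fintype C] (γ : ℝ) (P : C → Action → ℕ → C → ℝ)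
    (cog : C) (a : Action) : ℝ :=
  ∑' (τ : ℕ), ∑' (cog' : C), γ ^ τ * P cog a τ cog'

/-- The Q-value of action `a` at `(q, cog)` for the continuation value function `V`:
`Q_V(q,cog,a) = R((q,cog),a) + Σ_{τ,cog',w} γ^τ·P(τ,cog'|cog,a)·Poisson(λτ)(w)·V(q',cog')`. -/
noncomputable def Qval {C : Type*} [Fintype C] (c lam rH rN γ : ℝ)
    (Etau Etau2 : C → Action → ℝ) (P : C → Action → ℕ → C → ℝ)
    (V : ℤ → C → ℝ) (q : ℤ) (cog : C) (a : Action) : ℝ :=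
  Rimm c lam rH rN Etau Etau2 q cog a +
    ∑' (τ : ℕ), ∑' (cog' : C), ∑' (w : ℕ),
      γ ^ τ * P cog a τ cog' * poissonPMF (lam * (τ : ℝ)) w * V (nextQ a q w) cog'

/-- `V` satisfies the value-bound property with constants `t_s`, `t_max`, `ρ`:
for all `cog'`, `q` and `Δ ∈ ℕ`,
`c·t_s·Δ/(1 − γ^{t_max}) ≤ V(q,cog') − V(q+Δ,cog') ≤ c·t_max·Δ/(1 − ρ)`. -/
def ValueBound {C : Type*} (c γ ρ : ℝ) (ts tmax : ℕ) (V : ℤ → C → ℝ) : Prop :=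
  ∀ (cog' : C) (q : ℤ) (Δ : ℕ),
    c * (ts : ℝ) * (Δ : ℝ) / (1 - γ ^ tmax) ≤ V q cog' - V (q + (Δ : ℤ)) cog' ∧
    V q cog' - V (q + (Δ : ℤ)) cog' ≤ c * (tmax : ℝ) * (Δ : ℝ) / (1 - ρ)

lemma poissonPMF_nonneg {μ : ℝ} (hμ : 0 ≤ μ) (w : ℕ) : 0 ≤ poissonPMF μ w := by
  unfold poissonPMF; positivity

lemma hasSum_poissonPMF (μ : ℝ) : HasSum (poissonPMF μ) 1 := by
  have h := (NormedSpace.expSeries_div_hasSum_exp (𝔸 := ℝ) μ).mul_left (Real.exp (-μ))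
  rw [← Real.exp_eq_exp_ℝ, ← Real.exp_add, neg_add_cancel, Real.exp_zero] at h
  have hterm : poissonPMF μ = fun w => Real.exp (-μ) * (μ ^ w / w.factorial) :=
    funext fun w => mul_div_assoc _ _ _
  rwa [hterm]

lemma hasSum_mul_poissonPMF (μ : ℝ) : HasSum (fun w : ℕ => (w : ℝ) * poissonPMF μ w) μ := by
  rw [← hasSum_nat_add_iff' 1]
  have h := (hasSum_poissonPMF μ).mul_left μ
  have hterm : (fun w : ℕ => ((w + 1 : ℕ) : ℝ) * poissonPMF μ (w + 1)) =
      fun w => μ * poissonPMF μ w := by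
    funext w
    have h1 : ((w : ℝ) + 1) ≠ 0 := by positivity
    have h2 : (w.factorial : ℝ) ≠ 0 := by positivity
    simp only [poissonPMF, Nat.factorial_succ, Nat.cast_mul, Nat.cast_succ, pow_succ]
    field_simp
  rw [hterm]
  simpa using h

/-- The expectation of `f` under the Poisson law of mean `μ`. -/
noncomputable def poissonExp (μ : ℝ) (f : ℕ → ℝ) : ℝ :=
  ∑' w : ℕ, poissonPMF μ w * f w

lemma hasSum_poissonPMF_affine (μ A K : ℝ) :
    HasSum (fun w : ℕ => poissonPMF μ w * (A + K * w)) (A + K * μ) := by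
  have h := ((hasSum_poissonPMF μ).mul_left A).add ((hasSum_mul_poissonPMF μ).mul_left K)
  rw [mul_one] at h
  have hterm : (fun w : ℕ => poissonPMF μ w * (A + K * w)) =
      fun w => A * poissonPMF μ w + K * (w * poissonPMF μ w) := by
    funext w
    ring
  rwa [hterm]

lemma norm_poissonPMF_mul_le {μ A K : ℝ} (hμ : 0 ≤ μ) {f : ℕ → ℝ}
    (hf : ∀ w : ℕ, |f w| ≤ A + K * w) (w : ℕ) :
    ‖poissonPMF μ w * f w‖ ≤ poissonPMF μ w * (A + K * w) := by
  rw [norm_mul, Real.norm_eq_abs, Real.norm_eq_abs, abs_of_nonneg (poissonPMF_nonneg hμ w)]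
  exact mul_le_mul_of_nonneg_left (hf w) (poissonPMF_nonneg hμ w)

lemma summable_poissonPMF_mul {μ A K : ℝ} (hμ : 0 ≤ μ) {f : ℕ → ℝ}
    (hf : ∀ w : ℕ, |f w| ≤ A + K * w) : Summable fun w => poissonPMF μ w * f w :=
  Summable.of_norm_bounded (hasSum_poissonPMF_affine μ A K).summable
    (norm_poissonPMF_mul_le hμ hf)

lemma abs_poissonExp_le {μ A K : ℝ} (hμ : 0 ≤ μ) {f : ℕ → ℝ}
    (hf : ∀ w : ℕ, |f w| ≤ A + K * w) : |poissonExp μ f| ≤ A + K * μ :=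
  tsum_of_norm_bounded (hasSum_poissonPMF_affine μ A K) (norm_poissonPMF_mul_le hμ hf)

lemma poissonExp_sub_mem_Icc {μ L U : ℝ} (hμ : 0 ≤ μ) {f g : ℕ → ℝ}
    (hf : Summable fun w => poissonPMF μ w * f w)
    (hg : Summable fun w => poissonPMF μ w * g w)
    (hfg : ∀ w, f w - g w ∈ Set.Icc L U) :
    poissonExp μ f - poissonExp μ g ∈ Set.Icc L U := by
  have h := hf.hasSum.sub hg.hasSum
  have hL := (hasSum_poissonPMF μ).mul_right L
  have hU := (hasSum_poissonPMF μ).mul_right U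
  rw [one_mul] at hL hU
  refine ⟨hasSum_le (fun w => ?_) hL h, hasSum_le (fun w => ?_) h hU⟩
  · rw [← mul_sub]
    exact mul_le_mul_of_nonneg_left (hfg w).1 (poissonPMF_nonneg hμ w)
  · rw [← mul_sub]
    exact mul_le_mul_of_nonneg_left (hfg w).2 (poissonPMF_nonneg hμ w)

lemma ValueBound.abs_le {C : Type*} {c γ ρ : ℝ} {ts tmax : ℕ} {V : ℤ → C → ℝ}
    (hV : ValueBound c γ ρ ts tmax V) (hL : 0 ≤ c * ts / (1 - γ ^ tmax)) (q : ℤ) (x : C)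
    (w : ℕ) : |V (q + w) x| ≤ |V q x| + c * tmax / (1 - ρ) * w := by
  obtain ⟨h1, h2⟩ := hV x q w
  rw [mul_div_right_comm] at h1 h2
  have h3 : 0 ≤ c * ts / (1 - γ ^ tmax) * w := by positivity
  rw [_root_.abs_le]
  constructor <;> linarith [neg_abs_le (V q x), le_abs_self (V q x)]

lemma summable_nat_mul_of_sq {p : ℕ → ℝ} (hp : ∀ n, 0 ≤ p n)
    (h : Summable fun n : ℕ => (n : ℝ) ^ 2 * p n) : Summable fun n : ℕ => (n : ℝ) * p n := by
  refine Summable.of_nonneg_of_le (fun n => mul_nonneg n.cast_nonneg (hp n)) (fun n => ?_) h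
  refine mul_le_mul_of_nonneg_right ?_ (hp n)
  exact_mod_cast Nat.le_self_pow two_ne_zero n

lemma summable_of_nat_mul {p : ℕ → ℝ} (hp : ∀ n, 0 ≤ p n)
    (h : Summable fun n : ℕ => (n : ℝ) * p n) : Summable p := by
  rw [← summable_nat_add_iff 1] at h ⊢
  refine Summable.of_nonneg_of_le (fun n => hp _) (fun n => ?_) h
  have : (1 : ℝ) ≤ ((n + 1 : ℕ) : ℝ) := by exact_mod_cast Nat.succ_pos n
  exact le_mul_of_one_le_left (hp _) this

/-- Jensen's inequality for `t ↦ γ ^ t` and a probability mass function on `ℕ`. -/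
lemma rpow_mean_le_tsum {γ : ℝ} (hγ : γ ∈ Set.Ioo (0 : ℝ) 1) {p : ℕ → ℝ} (hp : ∀ n, 0 ≤ p n)
    {m : ℝ} (hsum : HasSum p 1) (hmean : HasSum (fun n : ℕ => (n : ℝ) * p n) m)
    (hdisc : Summable fun n : ℕ => γ ^ n * p n) : γ ^ m ≤ ∑' n : ℕ, γ ^ n * p n := by
  have h := (((hmean.sub (hsum.mul_left m)).mul_left (Real.log γ)).add hsum).mul_left (γ ^ m)
  rw [mul_one, sub_self, mul_zero, zero_add, mul_one] at h
  refine hasSum_le (fun n => ?_) h hdisc.hasSum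
  have hγn : γ ^ n = γ ^ m * Real.exp (Real.log γ * (n - m)) := by
    rw [← Real.rpow_def_of_pos hγ.1, ← Real.rpow_add hγ.1, add_sub_cancel, Real.rpow_natCast]
  have hpos : 0 < γ ^ m := Real.rpow_pos_of_pos hγ.1 m
  calc γ ^ m * (Real.log γ * ((n : ℝ) * p n - m * p n) + p n)
      = γ ^ m * (Real.log γ * (n - m) + 1) * p n := by ring
    _ ≤ γ ^ m * Real.exp (Real.log γ * (n - m)) * p n := by
        refine mul_le_mul_of_nonneg_right ?_ (hp n)
        exact mul_le_mul_of_nonneg_left (Real.add_one_le_exp _) hpos.le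
    _ = γ ^ n * p n := by rw [hγn]

lemma summable_pow_mul {γ : ℝ} (hγ : γ ∈ Set.Ioo (0 : ℝ) 1) {p : ℕ → ℝ} (hp : ∀ n, 0 ≤ p n)
    (h : Summable p) : Summable fun n : ℕ => γ ^ n * p n :=
  Summable.of_nonneg_of_le (fun n => mul_nonneg (pow_nonneg hγ.1.le n) (hp n))
    (fun n => mul_le_of_le_one_left (hp n) (pow_le_one₀ hγ.1.le hγ.2.le)) h

/-- Differences of discounted continuation values inherit uniform two-sided bounds, scaled by
the expected discount. -/
lemma tsum_discounted_sub_mem_Icc {C : Type*} [Fintype C] {γ A B L U : ℝ}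
    (hγ : γ ∈ Set.Ioo (0 : ℝ) 1) {p : ℕ → C → ℝ} (hp : ∀ n x, 0 ≤ p n x)
    (hmean : Summable fun n : ℕ => (n : ℝ) * ∑ x, p n x) {f g : ℕ → C → ℝ}
    (hf : ∀ n x, |f n x| ≤ A + B * n) (hg : ∀ n x, |g n x| ≤ A + B * n)
    (hfg : ∀ n x, f n x - g n x ∈ Set.Icc L U) :
    (∑' n, ∑ x, γ ^ n * p n x * f n x) - (∑' n, ∑ x, γ ^ n * p n x * g n x) ∈
      Set.Icc (L * ∑' n, γ ^ n * ∑ x, p n x) (U * ∑' n, γ ^ n * ∑ x, p n x) := by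
  have hp' : ∀ n, 0 ≤ ∑ x, p n x := fun n => Finset.sum_nonneg fun x _ => hp n x
  have hps := summable_of_nat_mul hp' hmean
  have hweight : ∀ n x, 0 ≤ γ ^ n * p n x := fun n x => mul_nonneg (pow_nonneg hγ.1.le n) (hp n x)
  have hsummable : ∀ f : ℕ → C → ℝ, (∀ n x, |f n x| ≤ A + B * n) →
      Summable fun n => ∑ x, γ ^ n * p n x * f n x := by
    intro f hf
    refine Summable.of_norm_bounded ((hps.mul_left A).add (hmean.mul_left B)) fun n => ?_
    calc ‖∑ x, γ ^ n * p n x * f n x‖ ≤ ∑ x, p n x * (A + B * n) := by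
          refine norm_sum_le_of_le _ fun x _ => ?_
          rw [norm_mul, Real.norm_eq_abs, Real.norm_eq_abs, abs_of_nonneg (hweight n x)]
          exact mul_le_mul (mul_le_of_le_one_left (hp n x) (pow_le_one₀ hγ.1.le hγ.2.le)) (hf n x)
            (abs_nonneg _) (hp n x)
      _ = A * ∑ x, p n x + B * ((n : ℝ) * ∑ x, p n x) := by rw [← Finset.sum_mul]; ring
  have h := (hsummable f hf).hasSum.sub (hsummable g hg).hasSum
  have hd := (summable_pow_mul hγ hp' hps).hasSum
  refine ⟨hasSum_le (fun n => ?_) (hd.mul_left L) h, hasSum_le (fun n => ?_) h (hd.mul_left U)⟩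
  · rw [← Finset.sum_sub_distrib, Finset.mul_sum, Finset.mul_sum]
    refine Finset.sum_le_sum fun x _ => ?_
    rw [← mul_sub, mul_comm L]
    exact mul_le_mul_of_nonneg_left (hfg n x).1 (hweight n x)
  · rw [← Finset.sum_sub_distrib, Finset.mul_sum, Finset.mul_sum]
    refine Finset.sum_le_sum fun x _ => ?_
    rw [← mul_sub, mul_comm U]
    exact mul_le_mul_of_nonneg_left (hfg n x).2 (hweight n x)

lemma Egamma_eq_tsum_sum {C : Type*} [Fintype C] (γ : ℝ) (P : C → Action → ℕ → C → ℝ)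
    (cog : C) (a : Action) : Egamma γ P cog a = ∑' n, γ ^ n * ∑ x, P cog a n x := by
  simp only [Egamma, tsum_fintype, Finset.mul_sum]

lemma Qval_eq_of_ne_R {C : Type*} [Fintype C] (c lam rH rN γ : ℝ)
    (Etau Etau2 : C → Action → ℝ) (P : C → Action → ℕ → C → ℝ)
    (V : ℤ → C → ℝ) (q : ℤ) (cog : C) {a : Action} (ha : a ≠ Action.R) :
    Qval c lam rH rN γ Etau Etau2 P V q cog a = Rimm c lam rH rN Etau Etau2 q cog a +
      ∑' n : ℕ, ∑ x, γ ^ n * P cog a n x *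
        poissonExp (lam * n) fun w => V (q - 1 + w) x := by
  simp only [Qval, nextQ, if_neg ha, tsum_fintype, poissonExp, ← tsum_mul_left, mul_assoc]

/-- Bounds on the decrease of the Q-value when the queue grows by `Δ`. -/
lemma Qval_sub_mem_Icc {C : Type*} [Fintype C] {c lam rH rN γ ρ : ℝ} {ts tmax : ℕ}
    {Etau Etau2 : C → Action → ℝ} {P : C → Action → ℕ → C → ℝ} {V : ℤ → C → ℝ}
    (hlam : 0 ≤ lam) (hγ : γ ∈ Set.Ioo (0 : ℝ) 1)
    (hL : 0 ≤ c * ts / (1 - γ ^ tmax)) (hV : ValueBound c γ ρ ts tmax V)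
    {cog : C} {a : Action} (ha : a ≠ Action.R) (hp : ∀ n x, 0 ≤ P cog a n x)
    (hmean : Summable fun n : ℕ => (n : ℝ) * ∑ x, P cog a n x) (q : ℤ) (Δ : ℕ) :
    Qval c lam rH rN γ Etau Etau2 P V q cog a -
        Qval c lam rH rN γ Etau Etau2 P V (q + Δ) cog a - c * Etau cog a * Δ ∈
      Set.Icc (c * ts / (1 - γ ^ tmax) * Δ * Egamma γ P cog a)
        (c * tmax / (1 - ρ) * Δ * Egamma γ P cog a) := by
  set K := c * tmax / (1 - ρ) with hK
  set A := ∑ x, (|V (q - 1) x| + |V (q + Δ - 1) x|) with hA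
  have hAle : ∀ x, |V (q - 1) x| + |V (q + Δ - 1) x| ≤ A := fun x =>
    Finset.single_le_sum (f := fun x => |V (q - 1) x| + |V (q + Δ - 1) x|)
      (fun y _ => by positivity) (Finset.mem_univ x)
  have hf : ∀ x (w : ℕ), |V (q - 1 + w) x| ≤ A + K * w := fun x w =>
    (hV.abs_le hL (q - 1) x w).trans
      (by linarith [hAle x, abs_nonneg (V (q + Δ - 1) x)])
  have hg : ∀ x (w : ℕ), |V (q + Δ - 1 + w) x| ≤ A + K * w := fun x w =>
    (hV.abs_le hL (q + Δ - 1) x w).trans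
      (by linarith [hAle x, abs_nonneg (V (q - 1) x)])
  have hμ : ∀ n : ℕ, 0 ≤ lam * n := fun n => by positivity
  have key := tsum_discounted_sub_mem_Icc (A := A) (B := K * lam)
    (L := c * ts / (1 - γ ^ tmax) * Δ) (U := K * Δ) hγ hp hmean
    (f := fun n x => poissonExp (lam * n) fun w => V (q - 1 + w) x)
    (g := fun n x => poissonExp (lam * n) fun w => V (q + Δ - 1 + w) x)
    (fun n x => by simpa only [mul_assoc] using abs_poissonExp_le (hμ n) (hf x))
    (fun n x => by simpa only [mul_assoc] using abs_poissonExp_le (hμ n) (hg x))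
    (fun n x => poissonExp_sub_mem_Icc (hμ n) (summable_poissonPMF_mul (hμ n) (hf x))
      (summable_poissonPMF_mul (hμ n) (hg x)) fun w => by
        have h := hV x (q - 1 + w) Δ
        rw [mul_div_right_comm, mul_div_right_comm (c * (tmax : ℝ)),
          show q - 1 + (w : ℤ) + Δ = q + Δ - 1 + w by ring] at h
        exact h)
  rw [← Egamma_eq_tsum_sum] at key
  rw [Qval_eq_of_ne_R _ _ _ _ _ _ _ _ _ _ _ ha, Qval_eq_of_ne_R _ _ _ _ _ _ _ _ _ _ _ ha]
  convert key using 1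
  simp only [Rimm, Int.cast_add, Int.cast_natCast]
  ring

/-- for `cog` with `cog > cog*`, if `V` satisfies the value-bound property,
`E[τ|cog,H] > E[τ|cog,N]`, and
`E[τ|cog,H] − E[τ|cog,N] + t_s·γ^{E[τ|cog,H]}/(1−γ^{t_max}) ≥ (t_max/(1−ρ))·E[γ^τ|cog,N]`,
then `q ↦ Q_V(q,cog,N) − Q_V(q,cog,H)` is nondecreasing; consequently once `N` strictly
dominates `H` it does so for all larger queue lengths. -/
theorem stmt11 {C : Type*} [LinearOrder C] [Fintype C]
    (cogStar : C) (c lam rH rN γ : ℝ) (ts : ℕ)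
    (Etau Etau2 : C → Action → ℝ) (P : C → Action → ℕ → C → ℝ)
    (hc : 0 < c) (hlam : 0 < lam) (hγ : γ ∈ Set.Ioo (0 : ℝ) 1)
    (hrN : 0 ≤ rN) (hrHN : rN < rH) (hts : 1 ≤ ts)
    (hPnn : ∀ cog a τ cog', 0 ≤ P cog a τ cog')
    (hP0 : ∀ cog a cog', P cog a 0 cog' = 0)
    (hPsum : ∀ cog, ∀ a ∈ Act cogStar cog, (∑' (τ : ℕ), ∑' (cog' : C), P cog a τ cog') = 1)
    (hPS : ∀ cog τ cog', τ ≠ ts → P cog Action.S τ cog' = 0)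
    (hEtau : ∀ cog a, Etau cog a = ∑' (τ : ℕ), ∑' (cog' : C), (τ : ℝ) * P cog a τ cog')
    (hEtau2 : ∀ cog a, Etau2 cog a = ∑' (τ : ℕ), ∑' (cog' : C), (τ : ℝ) ^ 2 * P cog a τ cog')
    (hMom2 : ∀ cog a, Summable fun τ : ℕ => (τ : ℝ) ^ 2 * ∑' (cog' : C), P cog a τ cog')
    (tmax : ℕ) (htmax : 1 ≤ tmax) (ρ : ℝ) (hρ : ρ ∈ Set.Ioo (0 : ℝ) 1)
    (hEle : ∀ cog, ∀ a ∈ Act cogStar cog, Etau cog a ≤ (tmax : ℝ))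
    (cog : C) (hcog : cogStar < cog)
    (V : ℤ → C → ℝ) (hV : ValueBound c γ ρ ts tmax V)
    (hHN : Etau cog Action.N < Etau cog Action.H)
    (hcond : Etau cog Action.H - Etau cog Action.N
          + (ts : ℝ) * γ ^ Etau cog Action.H / (1 - γ ^ tmax)
        ≥ (tmax : ℝ) / (1 - ρ) * Egamma γ P cog Action.N) :
    Monotone (fun q : ℤ => Qval c lam rH rN γ Etau Etau2 P V q cog Action.N - Qval c lam rH rN γ Etau Etau2 P V q cog Action.H) ∧
    ∀ q₁ q₂ : ℤ, q₁ ≤ q₂ →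
      Qval c lam rH rN γ Etau Etau2 P V q₁ cog Action.H < Qval c lam rH rN γ Etau Etau2 P V q₁ cog Action.N →
      Qval c lam rH rN γ Etau Etau2 P V q₂ cog Action.H < Qval c lam rH rN γ Etau Etau2 P V q₂ cog Action.N := by
  have hp : ∀ a n, 0 ≤ ∑ x, P cog a n x := fun a n => Finset.sum_nonneg fun x _ => hPnn _ _ _ _
  have hmean : ∀ a, Summable fun n : ℕ => (n : ℝ) * ∑ x, P cog a n x := fun a =>
    summable_nat_mul_of_sq (hp a) (by simpa only [tsum_fintype] using hMom2 cog a)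
  have hden : 0 < 1 - γ ^ tmax :=
    sub_pos.2 (pow_lt_one₀ hγ.1.le hγ.2 (Nat.one_le_iff_ne_zero.1 htmax))
  have hL : 0 ≤ c * ts / (1 - γ ^ tmax) := by positivity
  have hJensen : γ ^ Etau cog Action.H ≤ Egamma γ P cog Action.H := by
    have hps := summable_of_nat_mul (hp Action.H) (hmean Action.H)
    have h1 : ∑' n, ∑ x, P cog Action.H n x = 1 := by
      simpa only [tsum_fintype] using
        hPsum cog Action.H (by simp [Act, not_le.2 hcog])
    have hE : ∑' n : ℕ, (n : ℝ) * ∑ x, P cog Action.H n x = Etau cog Action.H := by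
      simp only [hEtau, tsum_fintype, Finset.mul_sum]
    rw [Egamma_eq_tsum_sum]
    exact rpow_mean_le_tsum hγ (hp Action.H) (h1 ▸ hps.hasSum) (hE ▸ (hmean Action.H).hasSum)
      (summable_pow_mul hγ (hp Action.H) hps)
  have hmono : Monotone (fun q : ℤ => Qval c lam rH rN γ Etau Etau2 P V q cog Action.N -
      Qval c lam rH rN γ Etau Etau2 P V q cog Action.H) := by
    intro q₁ q₂ hq
    obtain ⟨Δ, rfl⟩ := Int.le.dest hq
    have hN := (Qval_sub_mem_Icc (rH := rH) (rN := rN) (Etau := Etau) (Etau2 := Etau2) hlam.le hγ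
      hL hV (a := Action.N) (by decide) (hPnn cog _) (hmean _) q₁ Δ).2
    have hH := (Qval_sub_mem_Icc (rH := rH) (rN := rN) (Etau := Etau) (Etau2 := Etau2) hlam.le hγ
      hL hV (a := Action.H) (by decide) (hPnn cog _) (hmean _) q₁ Δ).1
    have hH' := mul_le_mul_of_nonneg_left hJensen
      (mul_nonneg hL (Nat.cast_nonneg (α := ℝ) Δ))
    have hcond' := mul_le_mul_of_nonneg_left hcond
      (mul_nonneg hc.le (Nat.cast_nonneg (α := ℝ) Δ))
    have e1 : c * Δ * (tmax / (1 - ρ) * Egamma γ P cog Action.N) =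
        c * tmax / (1 - ρ) * Δ * Egamma γ P cog Action.N := by ring
    have e2 : c * Δ * (Etau cog Action.H - Etau cog Action.N
          + ts * γ ^ Etau cog Action.H / (1 - γ ^ tmax)) =
        c * Etau cog Action.H * Δ - c * Etau cog Action.N * Δ +
          c * ts / (1 - γ ^ tmax) * Δ * γ ^ Etau cog Action.H := by ring
    rw [e1, e2] at hcond'
    dsimp only
    linarith
  refine ⟨hmono, fun q₁ q₂ hq h => ?_⟩
  have := hmono hq
  dsimp only at this
  linarith

end Fidelity
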